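/- arXiv:1808.10209 — 5 statements merged into one kernel-verified Lean document; each statement's English description precedes it below -/
import Mathlib

section
/- Every SSSCG in which all leader's cost functions are weakly monotonic and all followers' cost functions are strictly monotonic admits a pessimistic Stackelberg equilibrium (σ_ℓ, ν) in which the leader's strategy σ_ℓ is pure. -/
open Finset

/-- A leader strategy: a probability distribution over the resources. -/
def IsStrategy {R : Type} [Fintype R] (σ : R → ℚ) : Prop :=
  (∀ i, 0 ≤ σ i) ∧ ∑ i, σ i = 1

/-- A followers' configuration: `nF` followers distributed over the resources. -/
def IsConfig {R : Type} [Fintype R] (nF : ℕ) (ν : R → ℕ) : Prop :=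
  ∑ i, ν i = nF

/-- Followers' expected cost of a resource with cost function `c`, selected by the leader
with probability `p`, when `x` followers select it. -/
def expCost (c : ℕ → ℚ) (p : ℚ) (x : ℕ) : ℚ := p * c (x + 1) + (1 - p) * c x

/-- `ν` is a Nash equilibrium of the followers' game induced by the leader's strategy `σ`. -/
def IsNE {R : Type} [Fintype R] (cf : R → ℕ → ℚ) (σ : R → ℚ) (ν : R → ℕ) : Prop :=
  ∀ i j, i ≠ j → 0 < ν i → expCost (cf i) (σ i) (ν i) ≤ expCost (cf j) (σ j) (ν j + 1)

/-- The leader's expected cost. -/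
def leaderCost {R : Type} [Fintype R] (cl : R → ℕ → ℚ) (σ : R → ℚ) (ν : R → ℕ) : ℚ :=
  ∑ i, σ i * cl i (ν i + 1)

/-- The pure leader strategy on resource `i`. -/
def pureStrat {R : Type} [DecidableEq R] (i : R) : R → ℚ := fun j => if j = i then 1 else 0

/-- Rosenthal's potential of a singleton congestion game with cost functions `g`. -/
def rosenthalPotential {R : Type} [Fintype R] (g : R → ℕ → ℚ) (ν : R → ℕ) : ℚ :=
  ∑ i, ∑ x ∈ range (ν i), g i (x + 1)

theorem rosenthalPotential_add_single {R : Type} [Fintype R] [DecidableEq R]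
    (g : R → ℕ → ℚ) (β : R → ℕ) (k : R) :
    rosenthalPotential g (β + Pi.single k 1) = rosenthalPotential g β + g k (β k + 1) := by
  have hterm : ∀ i, ∑ x ∈ range ((β + Pi.single k 1 : R → ℕ) i), g i (x + 1)
      = ∑ x ∈ range (β i), g i (x + 1) + if i = k then g k (β k + 1) else 0 := by
    intro i
    by_cases h : i = k
    · subst h
      simp [sum_range_succ]
    · simp [h]
  simp only [rosenthalPotential, hterm, sum_add_distrib, sum_ite_eq', mem_univ, if_true]

theorem isConfig_iff_mem_piAntidiag {R : Type} [Fintype R] [DecidableEq R] {nF : ℕ}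
    {ν : R → ℕ} : IsConfig nF ν ↔ ν ∈ piAntidiag univ nF := by
  simp [IsConfig]

theorem exists_isConfig {R : Type} [Fintype R] [DecidableEq R] [Nonempty R] (nF : ℕ) :
    ∃ ν : R → ℕ, IsConfig nF ν :=
  ⟨Pi.single (Classical.arbitrary R) nF, by simp [IsConfig]⟩

/-- The followers' game has a Nash equilibrium for every leader strategy. -/
theorem exists_isNE {R : Type} [Fintype R] [DecidableEq R] [Nonempty R] (nF : ℕ)
    (cf : R → ℕ → ℚ) (σ : R → ℚ) : ∃ ν : R → ℕ, IsConfig nF ν ∧ IsNE cf σ ν := by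
  let g : R → ℕ → ℚ := fun i => expCost (cf i) (σ i)
  obtain ⟨μ, hμ⟩ := exists_isConfig (R := R) nF
  obtain ⟨ν, hν, hmin⟩ := exists_min_image (piAntidiag univ nF) (rosenthalPotential g)
    ⟨μ, isConfig_iff_mem_piAntidiag.1 hμ⟩
  rw [← isConfig_iff_mem_piAntidiag] at hν
  refine ⟨ν, hν, fun i j hij hpos => ?_⟩
  let β : R → ℕ := Function.update ν i (ν i - 1)
  have hβi : β i + 1 = ν i := by simp only [β, Function.update_self]; omega
  have hβj : β j = ν j := Function.update_of_ne hij.symm _ _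
  have hβν : β + Pi.single i 1 = ν := by
    ext k
    by_cases h : k = i
    · subst h
      simpa using hβi
    · simp [β, h]
  have hdev : IsConfig nF (β + Pi.single j 1) := by
    rw [← hβν] at hν
    simpa [IsConfig, sum_add_distrib] using hν
  have hle := hmin _ (isConfig_iff_mem_piAntidiag.1 hdev)
  rw [← hβν, rosenthalPotential_add_single, rosenthalPotential_add_single, hβi, hβj] at hle
  exact le_of_add_le_add_left hle

/-- Every leader strategy has a Nash equilibrium that is worst for the leader. -/
theorem exists_worst_isNE {R : Type} [Fintype R] [DecidableEq R] [Nonempty R] (nF : ℕ)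
    (cl cf : R → ℕ → ℚ) (σ : R → ℚ) :
    ∃ ν : R → ℕ, IsConfig nF ν ∧ IsNE cf σ ν ∧
      ∀ μ : R → ℕ, IsConfig nF μ → IsNE cf σ μ → leaderCost cl σ μ ≤ leaderCost cl σ ν := by
  classical
  obtain ⟨μ, hμ, hμNE⟩ := exists_isNE nF cf σ
  obtain ⟨ν, hν, hmax⟩ := exists_max_image ((piAntidiag univ nF).filter (IsNE cf σ))
    (leaderCost cl σ) ⟨μ, mem_filter.2 ⟨isConfig_iff_mem_piAntidiag.1 hμ, hμNE⟩⟩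
  rw [mem_filter, ← isConfig_iff_mem_piAntidiag] at hν
  exact ⟨ν, hν.1, hν.2, fun ρ hρ hρNE =>
    hmax ρ (mem_filter.2 ⟨isConfig_iff_mem_piAntidiag.1 hρ, hρNE⟩)⟩

theorem leaderCost_pureStrat {R : Type} [Fintype R] [DecidableEq R] (cl : R → ℕ → ℚ)
    (i : R) (ν : R → ℕ) : leaderCost cl (pureStrat i) ν = cl i (ν i + 1) := by
  simp [leaderCost, pureStrat]

theorem IsStrategy.eq_pureStrat {R : Type} [Fintype R] [DecidableEq R] {σ : R → ℚ}
    (hσ : IsStrategy σ) {i : R} (hi : σ i = 1) : σ = pureStrat i := by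
  have hsum := hσ.2
  rw [← add_sum_erase univ σ (mem_univ i), hi, add_eq_left,
    sum_eq_zero_iff_of_nonneg fun j _ => hσ.1 j] at hsum
  ext j
  by_cases h : j = i
  · simp [pureStrat, h, hi]
  · simp [pureStrat, h, hsum j (by simp [h])]

/-- If the leader selects `i` with probability less than one, then in every equilibrium at
least as many followers select `i` as in any equilibrium for the pure strategy on `i`. -/
theorem IsNE.le_of_pureStrat {R : Type} [Fintype R] [DecidableEq R] {nF : ℕ}
    {cf : R → ℕ → ℚ} (hfstrict : ∀ i x, cf i x < cf i (x + 1)) {σ : R → ℚ}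
    (hσ : ∀ i, 0 ≤ σ i) {i : R} (hi : σ i < 1) {ν μ : R → ℕ}
    (hν : IsConfig nF ν) (hνNE : IsNE cf σ ν)
    (hμ : IsConfig nF μ) (hμNE : IsNE cf (pureStrat i) μ) : μ i ≤ ν i := by
  by_contra! hlt
  obtain ⟨j, hj⟩ : ∃ j, μ j < ν j := by
    by_contra! hle
    have : ∑ k, ν k < ∑ k, μ k := sum_lt_sum (fun k _ => hle k) ⟨i, mem_univ i, hlt⟩
    exact this.ne (Eq.trans hν (Eq.symm hμ))
  have hji : j ≠ i := by
    rintro rfl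
    omega
  have hmono : ∀ k, Monotone (cf k) := fun k => monotone_nat_of_le_succ fun x => (hfstrict k x).le
  have hleave := hνNE j i hji (by omega)
  have hstay := hμNE i j hji.symm (by omega)
  simp only [expCost, pureStrat, if_true, if_neg hji] at hleave hstay
  have hcost_i : cf i (ν i + 1 + 1) ≤ cf i (μ i + 1) := hmono i (by omega)
  have hcost_j : cf j (μ j + 1) ≤ cf j (ν j) := hmono j hj
  nlinarith [mul_pos (sub_pos.2 hi) (sub_pos.2 (hfstrict i (ν i + 1))),
    mul_nonneg (hσ j) (sub_nonneg.2 (hfstrict j (ν j)).le)]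

/-- Every SSSCG with weakly monotonic leader's cost functions and strictly monotonic
followers' cost functions admits a pessimistic Stackelberg equilibrium in which the
leader's strategy is pure. -/
theorem stmt3 {R : Type} [Fintype R] [DecidableEq R] [Nonempty R] (nF : ℕ)
    (cl cf : R → ℕ → ℚ)
    (hl0 : ∀ i, cl i 0 = 0) (hf0 : ∀ i, cf i 0 = 0)
    (hlmono : ∀ i x, cl i x ≤ cl i (x + 1)) (hfstrict : ∀ i x, cf i x < cf i (x + 1)) :
    ∃ (istar : R) (ν : R → ℕ),
      IsConfig nF ν ∧ IsNE cf (pureStrat istar) ν ∧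
      -- ν attains the maximum leader's cost over the NEs for the pure strategy on istar
      (∀ ν'' : R → ℕ, IsConfig nF ν'' → IsNE cf (pureStrat istar) ν'' →
        leaderCost cl (pureStrat istar) ν'' ≤ leaderCost cl (pureStrat istar) ν) ∧
      -- and for every leader strategy σ', the worst NE for σ' costs the leader at least as much
      (∀ σ' : R → ℚ, IsStrategy σ' →
        ∃ ν' : R → ℕ, IsConfig nF ν' ∧ IsNE cf σ' ν' ∧
          leaderCost cl (pureStrat istar) ν ≤ leaderCost cl σ' ν') := by
  choose worst hconfig hNE hworst using fun i => exists_worst_isNE nF cl cf (pureStrat i)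
  obtain ⟨istar, hmin⟩ :=
    Finite.exists_min fun i => leaderCost cl (pureStrat i) (worst i)
  refine ⟨istar, worst istar, hconfig istar, hNE istar, hworst istar, fun σ hσ => ?_⟩
  by_cases hpure : ∃ i, σ i = 1
  · obtain ⟨i, hi⟩ := hpure
    rw [hσ.eq_pureStrat hi]
    exact ⟨worst i, hconfig i, hNE i, hmin i⟩
  push Not at hpure
  obtain ⟨ν, hν, hνNE⟩ := exists_isNE nF cf σ
  refine ⟨ν, hν, hνNE, ?_⟩
  have hcost : ∀ i, leaderCost cl (pureStrat istar) (worst istar) ≤ cl i (ν i + 1) := by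
    intro i
    have hle : σ i ≤ 1 := hσ.2 ▸ single_le_sum (fun j _ => hσ.1 j) (mem_univ i)
    have hload := IsNE.le_of_pureStrat hfstrict hσ.1 (lt_of_le_of_ne hle (hpure i)) hν hνNE
      (hconfig i) (hNE i)
    refine (hmin i).trans ?_
    rw [leaderCost_pureStrat]
    exact monotone_nat_of_le_succ (hlmono i) (Nat.add_le_add_right hload 1)
  calc leaderCost cl (pureStrat istar) (worst istar)
      = ∑ i, σ i * leaderCost cl (pureStrat istar) (worst istar) := by
        rw [← sum_mul, hσ.2, one_mul]
    _ ≤ leaderCost cl σ ν :=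
        sum_le_sum fun i _ => mul_le_mul_of_nonneg_left (hcost i) (hσ.1 i)
end

section
/- Let an SSSCG have weakly monotonic leader's cost functions and strictly monotonic followers' cost functions. Let σ_ℓ be a non-pure leader strategy (σ_ℓ(i) < 1 for every i ∈ R), let ν ∈ E^{σ_ℓ}, and let i* minimize c_{i,ℓ}(ν_i + 1) over the resources i with σ_ℓ(i) > 0. Let σ̂_ℓ be the pure leader strategy with σ̂_ℓ(i*) = 1. Then every configuration ν̂ ∈ E^{σ̂_ℓ} satisfies c_{i*,ℓ}(ν̂_{i*} + 1) ≤ c_{i*,ℓ}(ν_{i*} + 1) ≤ c_ℓ^{(σ_ℓ,ν)}; i.e., the pure commitment on i* yields leader's cost at most c_ℓ^{(σ_ℓ,ν)} at every Nash equilibrium of the induced followers' game. -/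
open Finset

/-- The expected cost is at least the cost without the leader. -/
lemma le_expCost {c : ℕ → ℚ} (hc : Monotone c) {p : ℚ} (hp : 0 ≤ p) (x : ℕ) :
    c x ≤ expCost c p x := by
  unfold expCost
  nlinarith [mul_le_mul_of_nonneg_left (hc x.le_succ) hp]

/-- If the leader does not play a resource with certainty, its expected cost is smaller than
the cost with the leader. -/
lemma expCost_lt {c : ℕ → ℚ} (hc : StrictMono c) {p : ℚ} (hp : p < 1) (x : ℕ) :
    expCost c p x < c (x + 1) := by
  unfold expCost
  nlinarith [mul_lt_mul_of_pos_left (hc x.lt_succ_self) (sub_pos.mpr hp)]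

/-- Moving from a non-pure leader strategy to the pure one on `i` does not increase the number
of followers on `i` at equilibrium. -/
lemma le_of_isNE_pureStrat {R : Type} [Fintype R] [DecidableEq R] {nF : ℕ}
    {cf : R → ℕ → ℚ} (hcf : ∀ i, StrictMono (cf i)) {σ : R → ℚ} (hσ : ∀ i, 0 ≤ σ i)
    {i : R} (hi : σ i < 1) {ν νh : R → ℕ} (hν : IsConfig nF ν) (hNE : IsNE cf σ ν)
    (hνh : IsConfig nF νh) (hNEh : IsNE cf (pureStrat i) νh) : νh i ≤ ν i := by
  by_contra! hlt
  obtain ⟨j, hj⟩ : ∃ j, νh j < ν j := by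
    by_contra! hle
    have hsum : ∑ k, ν k < ∑ k, νh k :=
      Finset.sum_lt_sum (fun k _ => hle k) ⟨i, Finset.mem_univ i, hlt⟩
    exact absurd (hν.trans hνh.symm) hsum.ne
  have hji : j ≠ i := by
    rintro rfl
    omega
  have hdev := hNEh i j hji.symm (by omega)
  simp only [expCost, pureStrat, if_true, if_neg hji] at hdev
  have hdev' := hNE j i hji (by omega)
  have hlow := le_expCost (hcf j).monotone (hσ j) (ν j)
  have hupp := expCost_lt (hcf i) hi (ν i + 1)
  have hmonoj : cf j (νh j + 1) ≤ cf j (ν j) := (hcf j).monotone hj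
  have hmonoi : cf i (ν i + 1 + 1) ≤ cf i (νh i + 1) := (hcf i).monotone (by omega)
  linarith

/-- A cost that is minimal on the support of the leader's strategy bounds the expected cost
from below. -/
lemma le_leaderCost {R : Type} [Fintype R] {cl : R → ℕ → ℚ} {σ : R → ℚ} (hσ : IsStrategy σ)
    {ν : R → ℕ} {m : ℚ} (hm : ∀ i, 0 < σ i → m ≤ cl i (ν i + 1)) : m ≤ leaderCost cl σ ν := by
  calc m = ∑ i, σ i * m := by rw [← Finset.sum_mul, hσ.2, one_mul]
    _ ≤ leaderCost cl σ ν := Finset.sum_le_sum fun i _ => by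
      rcases (hσ.1 i).eq_or_lt with h | h
      · simp [← h]
      · exact mul_le_mul_of_nonneg_left (hm i h) h.le

/-- Let the leader's cost functions be weakly monotonic and the followers' ones strictly
monotonic. Given a non-pure leader strategy `σ`, an NE `ν` for it, and a resource `i*` of
minimum leader's cost among those played with positive probability, EVERY NE `ν̂` of the
followers' game induced by the pure commitment on `i*` yields leader's cost
`c_{i*,ℓ}(ν̂_{i*}+1) ≤ c_{i*,ℓ}(ν_{i*}+1) ≤ c_ℓ^{(σ,ν)}`. -/
theorem stmt5 {R : Type} [Fintype R] [DecidableEq R] (nF : ℕ)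
    (cl cf : R → ℕ → ℚ)
    (hl0 : ∀ i, cl i 0 = 0) (hf0 : ∀ i, cf i 0 = 0)
    (hlmono : ∀ i x, cl i x ≤ cl i (x + 1)) (hfstrict : ∀ i x, cf i x < cf i (x + 1))
    (σ : R → ℚ) (hσ : IsStrategy σ) (hnonpure : ∀ i, σ i < 1)
    (ν : R → ℕ) (hν : IsConfig nF ν) (hNE : IsNE cf σ ν)
    (istar : R) (hpos : 0 < σ istar)
    (hmin : ∀ i, 0 < σ i → cl istar (ν istar + 1) ≤ cl i (ν i + 1)) :
    ∀ νh : R → ℕ, IsConfig nF νh → IsNE cf (pureStrat istar) νh →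
      cl istar (νh istar + 1) ≤ cl istar (ν istar + 1) ∧
      cl istar (ν istar + 1) ≤ leaderCost cl σ ν := by
  intro νh hνh hNEh
  have hle : νh istar ≤ ν istar :=
    le_of_isNE_pureStrat (fun i => strictMono_nat_of_lt_succ (hfstrict i)) hσ.1
      (hnonpure istar) hν hNE hνh hNEh
  exact ⟨monotone_nat_of_le_succ (hlmono istar) (Nat.succ_le_succ hle), le_leaderCost hσ hmin⟩
end

section
/- Consider the SSSCG with one follower (|F| = 1), two resources R = {r1, r2}, monotonic leader costs c_{r1,ℓ}(1) = c_{r2,ℓ}(1) = 1, c_{r1,ℓ}(2) = c_{r2,ℓ}(2) = 2, and nonmonotonic follower costs c_{r1,f}(1) = c_{r2,f}(1) = 2, c_{r1,f}(2) = c_{r2,f}(2) = 1. Then for every leader strategy σ_ℓ and every ν ∈ E^{σ_ℓ}, c_ℓ^{(σ_ℓ,ν)} ≥ 3/2, with equality if and only if σ_ℓ(r1) = σ_ℓ(r2) = 1/2. In particular, every optimistic and every pessimistic Stackelberg equilibrium of this game prescribes the leader the mixed strategy σ_ℓ(r1) = σ_ℓ(r2) = 1/2. -/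
open Finset

/-- Monotonic leader's costs: `c_{r,ℓ}(1) = 1, c_{r,ℓ}(2) = 2` on both resources. -/
def cl7 : Fin 2 → ℕ → ℚ := fun _ x => if x = 0 then 0 else if x = 1 then 1 else 2

/-- Nonmonotonic followers' costs: `c_{r,f}(1) = 2, c_{r,f}(2) = 1` on both resources. -/
def cf7 : Fin 2 → ℕ → ℚ := fun _ x => if x = 0 then 0 else if x = 1 then 2 else 1

/-- `(σ, ν)` is an optimistic Stackelberg equilibrium of the game. -/
def IsOSE7 (σ : Fin 2 → ℚ) (ν : Fin 2 → ℕ) : Prop :=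
  IsStrategy σ ∧ IsConfig 1 ν ∧ IsNE cf7 σ ν ∧
  (∀ (σ' : Fin 2 → ℚ) (ν' : Fin 2 → ℕ), IsStrategy σ' → IsConfig 1 ν' → IsNE cf7 σ' ν' →
    leaderCost cl7 σ ν ≤ leaderCost cl7 σ' ν')

/-- `(σ, ν)` is a pessimistic Stackelberg equilibrium of the game. -/
def IsPSE7 (σ : Fin 2 → ℚ) (ν : Fin 2 → ℕ) : Prop :=
  IsStrategy σ ∧ IsConfig 1 ν ∧ IsNE cf7 σ ν ∧
  (∀ ν'' : Fin 2 → ℕ, IsConfig 1 ν'' → IsNE cf7 σ ν'' →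
    leaderCost cl7 σ ν'' ≤ leaderCost cl7 σ ν) ∧
  (∀ σ' : Fin 2 → ℚ, IsStrategy σ' →
    ∃ ν' : Fin 2 → ℕ, IsConfig 1 ν' ∧ IsNE cf7 σ' ν' ∧
      leaderCost cl7 σ ν ≤ leaderCost cl7 σ' ν')

/-- At a Nash equilibrium the leader pays at least `3 / 2`, with equality exactly when she
mixes uniformly. -/
theorem three_halves_le_leaderCost {σ : Fin 2 → ℚ} {ν : Fin 2 → ℕ} (hσ : IsStrategy σ)
    (hν : IsConfig 1 ν) (hNE : IsNE cf7 σ ν) :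
    3 / 2 ≤ leaderCost cl7 σ ν ∧
      (leaderCost cl7 σ ν = 3 / 2 ↔ σ 0 = 1 / 2 ∧ σ 1 = 1 / 2) := by
  have hsum : σ 0 + σ 1 = 1 := by simpa [Fin.sum_univ_two] using hσ.2
  have hcount : ν 0 + ν 1 = 1 := by simpa [IsConfig, Fin.sum_univ_two] using hν
  have h01 := hNE 0 1 (by decide)
  have h10 := hNE 1 0 (by decide)
  obtain ⟨h0, h1⟩ | ⟨h0, h1⟩ : (ν 0 = 0 ∧ ν 1 = 1) ∨ (ν 0 = 1 ∧ ν 1 = 0) := by omega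
  · norm_num [h0, h1, expCost, cf7] at h10
    have hcost : leaderCost cl7 σ ν = σ 0 + σ 1 * 2 := by
      simp [leaderCost, Fin.sum_univ_two, cl7, h0, h1]
    rw [hcost]
    refine ⟨by linarith, fun h => ⟨by linarith, by linarith⟩, fun h => by linarith [h.1, h.2]⟩
  · norm_num [h0, h1, expCost, cf7] at h01
    have hcost : leaderCost cl7 σ ν = σ 0 * 2 + σ 1 := by
      simp [leaderCost, Fin.sum_univ_two, cl7, h0, h1]
    rw [hcost]
    refine ⟨by linarith, fun h => ⟨by linarith, by linarith⟩, fun h => by linarith [h.1, h.2]⟩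

theorem isStrategy_uniform : IsStrategy (fun _ : Fin 2 => (1 / 2 : ℚ)) :=
  ⟨fun _ => by norm_num, by norm_num⟩

theorem isNE_uniform : IsNE cf7 (fun _ => 1 / 2) ![1, 0] := by
  intro i j hij hi
  fin_cases i <;> fin_cases j <;> simp_all [expCost, cf7]

theorem leaderCost_uniform {ν : Fin 2 → ℕ} (hν : IsConfig 1 ν)
    (hNE : IsNE cf7 (fun _ => 1 / 2) ν) : leaderCost cl7 (fun _ => 1 / 2) ν = 3 / 2 :=
  (three_halves_le_leaderCost isStrategy_uniform hν hNE).2.2 ⟨rfl, rfl⟩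

theorem stmt7 :
    -- for every leader strategy and every NE, the leader's cost is at least 3/2,
    -- with equality iff σ(r1) = σ(r2) = 1/2
    (∀ (σ : Fin 2 → ℚ) (ν : Fin 2 → ℕ), IsStrategy σ → IsConfig 1 ν → IsNE cf7 σ ν →
      3 / 2 ≤ leaderCost cl7 σ ν ∧
      (leaderCost cl7 σ ν = 3 / 2 ↔ σ 0 = 1 / 2 ∧ σ 1 = 1 / 2)) ∧
    -- in particular, every OSE and every PSE prescribes the mixed strategy (1/2, 1/2)
    (∀ (σ : Fin 2 → ℚ) (ν : Fin 2 → ℕ), IsOSE7 σ ν → σ 0 = 1 / 2 ∧ σ 1 = 1 / 2) ∧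
    (∀ (σ : Fin 2 → ℚ) (ν : Fin 2 → ℕ), IsPSE7 σ ν → σ 0 = 1 / 2 ∧ σ 1 = 1 / 2) := by
  refine ⟨fun σ ν => three_halves_le_leaderCost, ?_, ?_⟩
  · rintro σ ν ⟨hσ, hν, hNE, hopt⟩
    have hconf : IsConfig 1 (![1, 0] : Fin 2 → ℕ) := by simp [IsConfig]
    have hle := hopt _ _ isStrategy_uniform hconf isNE_uniform
    rw [leaderCost_uniform hconf isNE_uniform] at hle
    have h := three_halves_le_leaderCost hσ hν hNE
    exact h.2.1 (le_antisymm hle h.1)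
  · rintro σ ν ⟨hσ, hν, hNE, -, hopt⟩
    obtain ⟨ν', hν', hNE', hle⟩ := hopt _ isStrategy_uniform
    rw [leaderCost_uniform hν' hNE'] at hle
    have h := three_halves_le_leaderCost hσ hν hNE
    exact h.2.1 (le_antisymm hle h.1)
end

section
/- Let x_1, …, x_N be positive integers with N even, Σ_i x_i even, s := (Σ_i x_i)/2, x_i ≤ s for all i, and w_i := x_i/s; fix an integer K with 1 ≤ K ≤ N/2 and a rational ε with 0 < ε < 1. If there is no set I ⊆ {1, …, N} with |I| = K and Σ_{i∈I} x_i = s, then in the game Γ_ε(S,K) (an SSSCG defined in the context), for every leader strategy σ_ℓ and every configuration ν ∈ E^{σ_ℓ}, the leader's expected cost satisfies c_ℓ^{(σ_ℓ,ν)} ≥ 1. -/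
open Finset

/-! The game `Γ_ε(S,K)`. Resources are `Sum.inl i` (the resource `r_i` associated with the
integer `x_i`, `i < N`), `Sum.inr false` (the resource `r_{t1}`) and `Sum.inr true` (the
resource `r_{t2}`). There are `4N + 2` followers. Below, `w_i = x_i / s`, so that
`1 / w_i = s / x_i`. -/

/-- The followers' cost functions of `Γ_ε(S,K)`. -/
def cfGK (N K s : ℕ) (x : Fin N → ℕ) : Fin N ⊕ Bool → ℕ → ℚ := fun r m =>
  match r with
  | Sum.inl i =>
      if m = 0 then 0
      else if m = 1 then 2 * (s : ℚ)
      else if m = 2 then 0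
      else if m = 3 then (s : ℚ) / (x i : ℚ)
      else if m = 4 then (2 * (s : ℚ) - (s : ℚ) / (x i : ℚ) + 1) * ((s : ℚ) / (x i : ℚ))
      else 4 * (s : ℚ) ^ 2
  | Sum.inr false =>
      if m = 0 then 0
      else if m ≤ 4 * N - 2 * K then 3 * (s : ℚ) ^ 2
      else if m = 4 * N - 2 * K + 1 then 2 * (s : ℚ)
      else if m = 4 * N - 2 * K + 2 then 1
      else 0
  | Sum.inr true =>
      if m = 0 then 0 else if m = 1 then 1 else 4 * (s : ℚ) ^ 2

/-- The leader's cost functions of `Γ_ε(S,K)`. -/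
def clGK (N s : ℕ) (ε : ℚ) : Fin N ⊕ Bool → ℕ → ℚ := fun r m =>
  match r with
  | Sum.inl _ => if m = 0 then 0 else if m = 3 then ε else (s : ℚ)
  | Sum.inr _ => if m = 0 then 0 else (s : ℚ) ^ 4

/-- An expected cost is bounded above by any common bound of the two costs it averages. -/
lemma expCost_le {c : ℕ → ℚ} {p B : ℚ} {m : ℕ} (hp0 : 0 ≤ p) (hp1 : p ≤ 1)
    (h1 : c (m + 1) ≤ B) (h2 : c m ≤ B) : expCost c p m ≤ B := by
  unfold expCost
  nlinarith [mul_le_mul_of_nonneg_left h1 hp0,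
    mul_le_mul_of_nonneg_left h2 (sub_nonneg.2 hp1)]

section Costs

variable {N K s : ℕ} {x : Fin N → ℕ}

lemma expCost_inl_one (i : Fin N) (p : ℚ) :
    expCost (cfGK N K s x (Sum.inl i)) p 1 = 2 * (s : ℚ) * (1 - p) := by
  simp [expCost, cfGK]; ring

lemma expCost_inl_two (i : Fin N) (p : ℚ) :
    expCost (cfGK N K s x (Sum.inl i)) p 2 = p * ((s : ℚ) / x i) := by
  simp [expCost, cfGK]

lemma expCost_inl_three (i : Fin N) (p : ℚ) :
    expCost (cfGK N K s x (Sum.inl i)) p 3 =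
      ((s : ℚ) / x i) * (1 + p * (2 * s - (s : ℚ) / x i)) := by
  simp [expCost, cfGK]; ring

lemma expCost_inl_four (i : Fin N) (p : ℚ) :
    expCost (cfGK N K s x (Sum.inl i)) p 4 =
      p * (4 * (s : ℚ) ^ 2) + (1 - p) *
        ((2 * (s : ℚ) - (s : ℚ) / (x i : ℚ) + 1) * ((s : ℚ) / (x i : ℚ))) := by
  simp [expCost, cfGK]

lemma expCost_inl_of_five_le (i : Fin N) (p : ℚ) {m : ℕ} (hm : 5 ≤ m) :
    expCost (cfGK N K s x (Sum.inl i)) p m = 4 * (s : ℚ) ^ 2 := by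
  have h : ∀ k, 5 ≤ k → cfGK N K s x (Sum.inl i) k = 4 * (s : ℚ) ^ 2 := by
    intro k hk
    simp [cfGK, show k ≠ 0 by omega, show k ≠ 1 by omega, show k ≠ 2 by omega,
      show k ≠ 3 by omega, show k ≠ 4 by omega]
  rw [expCost, h _ hm, h _ (by omega)]; ring

lemma expCost_inr_true_one (p : ℚ) :
    expCost (cfGK N K s x (Sum.inr true)) p 1 = p * (4 * (s : ℚ) ^ 2) + (1 - p) := by
  simp [expCost, cfGK]

lemma expCost_inr_true_of_two_le (p : ℚ) {m : ℕ} (hm : 2 ≤ m) :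
    expCost (cfGK N K s x (Sum.inr true)) p m = 4 * (s : ℚ) ^ 2 := by
  simp [expCost, cfGK, show m ≠ 0 by omega, show m ≠ 1 by omega]; ring

lemma cfGK_inr_false_le (hs : 1 ≤ s) (m : ℕ) :
    cfGK N K s x (Sum.inr false) m ≤ 3 * (s : ℚ) ^ 2 := by
  have hs' : (1 : ℚ) ≤ s := by exact_mod_cast hs
  simp only [cfGK]
  split_ifs <;> nlinarith

lemma expCost_inr_false_of_lt (p : ℚ) {m : ℕ} (hm0 : 0 < m) (hm : m < 4 * N - 2 * K) :
    expCost (cfGK N K s x (Sum.inr false)) p m = 3 * (s : ℚ) ^ 2 := by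
  simp [expCost, cfGK, show m ≠ 0 by omega, show m + 1 ≤ 4 * N - 2 * K by omega, hm.le]; ring

lemma expCost_inr_false_of_eq (p : ℚ) {m : ℕ} (hm0 : 0 < m) (hm : m = 4 * N - 2 * K) :
    expCost (cfGK N K s x (Sum.inr false)) p m =
      p * (2 * (s : ℚ)) + (1 - p) * (3 * (s : ℚ) ^ 2) := by
  subst hm
  simp [expCost, cfGK, hm0.ne']

lemma expCost_inr_false_add_one (p : ℚ) :
    expCost (cfGK N K s x (Sum.inr false)) p (4 * N - 2 * K + 1) =
      p + (1 - p) * (2 * (s : ℚ)) := by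
  simp [expCost, cfGK]

lemma expCost_inr_false_add_two (p : ℚ) :
    expCost (cfGK N K s x (Sum.inr false)) p (4 * N - 2 * K + 2) = 1 - p := by
  simp [expCost, cfGK]

lemma expCost_inr_false_of_add_three_le (p : ℚ) {m : ℕ} (hm : 4 * N - 2 * K + 3 ≤ m) :
    expCost (cfGK N K s x (Sum.inr false)) p m = 0 := by
  have h : ∀ k, 4 * N - 2 * K + 3 ≤ k → cfGK N K s x (Sum.inr false) k = 0 := by
    intro k hk
    simp [cfGK, show ¬ k ≤ 4 * N - 2 * K by omega, show k ≠ 4 * N - 2 * K + 1 by omega,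
      show k ≠ 4 * N - 2 * K + 2 by omega]
  rw [expCost, h _ hm, h _ (by omega)]; ring

end Costs

/-- An instance with answer no has `s ≥ 2`. -/
lemma two_le_of_no_partition {N K s : ℕ} {x : Fin N → ℕ}
    (hxpos : ∀ i, 0 < x i) (hxle : ∀ i, x i ≤ s) (hsum : ∑ i, x i = 2 * s)
    (hK1 : 1 ≤ K) (hK2 : 2 * K ≤ N)
    (hno : ¬ ∃ I : Finset (Fin N), I.card = K ∧ ∑ i ∈ I, x i = s) : 2 ≤ s := by
  by_contra! hs
  have hx : ∀ i, x i = 1 := fun i => by have := hxpos i; have := hxle i; omega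
  simp only [hx, sum_const, card_univ, Fintype.card_fin, smul_eq_mul, mul_one] at hsum
  obtain ⟨I, -, hI⟩ := Finset.exists_subset_card_eq (s := (univ : Finset (Fin N))) (n := K)
    (by simp; omega)
  refine hno ⟨I, hI, ?_⟩
  simp only [hx, sum_const, smul_eq_mul, mul_one]
  omega

/-- In an equilibrium where `r_{t1}` costs its users `2s` and deviating to it costs `1`, the
resource `r_i` has 0, 2 or 3 followers; in the second case the leader plays it with probability
`x_i / s`, otherwise with probability 0, and three followers force `x_i = s`. -/
lemma followers_cases {N K s : ℕ} {x : Fin N → ℕ} {i : Fin N} {p : ℚ} {n : ℕ}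
    (hs : (2 : ℚ) ≤ s) (hxpos : 0 < x i) (hxle : x i ≤ s) (h0 : 0 ≤ p) (h1 : p ≤ 1)
    (h4 : n ≤ 4) (hb : n ≠ 2 → p * s < 1)
    (hle : 0 < n → expCost (cfGK N K s x (Sum.inl i)) p n ≤ 1)
    (hfr : 2 * (s : ℚ) ≤ expCost (cfGK N K s x (Sum.inl i)) p (n + 1)) :
    (n = 0 ∧ p = 0) ∨ (n = 2 ∧ p * s = x i) ∨ (n = 3 ∧ p = 0 ∧ x i = s) := by
  have hxp : (0 : ℚ) < x i := by exact_mod_cast hxpos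
  have hu : (1 : ℚ) ≤ (s : ℚ) / x i := by
    rw [one_le_div hxp]; exact_mod_cast hxle
  have hu' : (s : ℚ) / x i ≤ s :=
    div_le_self (by linarith) (by exact_mod_cast hxpos)
  have hx0 : (s : ℚ) / x i * x i = s := div_mul_cancel₀ _ hxp.ne'
  interval_cases n
  · left
    rw [zero_add, expCost_inl_one] at hfr
    exact ⟨rfl, by nlinarith⟩
  · exfalso
    have h2 := hle one_pos
    rw [expCost_inl_one] at h2
    have h3 := hb (by omega)
    nlinarith
  · right; left
    refine ⟨rfl, ?_⟩
    have h2 := hle two_pos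
    rw [expCost_inl_two] at h2
    rw [expCost_inl_three] at hfr
    generalize (s : ℚ) / x i = u at *
    have h3 : 1 ≤ p * u := by
      by_contra! h
      nlinarith [mul_lt_mul_of_pos_right h (by linarith : 0 < 2 * (s : ℚ) - u)]
    have h5 : p * u = 1 := le_antisymm h2 h3
    rw [← hx0, ← mul_assoc, h5, one_mul]
  · right; right
    have h2 := hle (by omega)
    rw [expCost_inl_three] at h2
    generalize (s : ℚ) / x i = u at *
    have h5 : 0 ≤ p * (2 * s - u) := mul_nonneg h0 (by linarith)
    have h6 : u = 1 := by nlinarith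
    subst h6
    refine ⟨rfl, by nlinarith, ?_⟩
    rw [one_mul] at hx0
    exact_mod_cast hx0
  · exfalso
    have h2 := hle (by omega)
    rw [expCost_inl_four] at h2
    generalize (s : ℚ) / x i = u at *
    have h3 : 2 * (s : ℚ) ≤ (2 * s - u + 1) * u := by nlinarith
    nlinarith [mul_le_mul_of_nonneg_left h3 (sub_nonneg.2 h1),
      mul_nonneg h0 (by nlinarith : (0 : ℚ) ≤ 4 * (s : ℚ) ^ 2 - 2 * s)]

/-- If the `K`-PARTITION instance has answer no, then in `Γ_ε(S,K)` every leader's strategy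
and every induced NE give the leader an expected cost of at least `1`. -/
theorem stmt12 (N K s : ℕ) (x : Fin N → ℕ)
    (hNeven : Even N) (hxpos : ∀ i, 0 < x i) (hxle : ∀ i, x i ≤ s)
    (hsum : ∑ i, x i = 2 * s)
    (hK1 : 1 ≤ K) (hK2 : 2 * K ≤ N)
    (ε : ℚ) (hε0 : 0 < ε) (hε1 : ε < 1)
    (hno : ¬ ∃ I : Finset (Fin N), I.card = K ∧ ∑ i ∈ I, x i = s) :
    ∀ (σ : Fin N ⊕ Bool → ℚ) (ν : Fin N ⊕ Bool → ℕ),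
      IsStrategy σ → IsConfig (4 * N + 2) ν → IsNE (cfGK N K s x) σ ν →
      1 ≤ leaderCost (clGK N s ε) σ ν := by
  intro σ ν hσ hν hne
  have hs2 : 2 ≤ s := two_le_of_no_partition hxpos hxle hsum hK1 hK2 hno
  have hs : (2 : ℚ) ≤ s := by exact_mod_cast hs2
  have hσ0 := hσ.1
  have hσ1 : ∀ r, σ r ≤ 1 := fun r => by
    rw [← hσ.2]; exact single_le_sum (f := σ) (fun j _ => hσ0 j) (mem_univ r)
  have hu1 : ∀ i, (1 : ℚ) ≤ (s : ℚ) / x i := fun i => by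
    rw [one_le_div (by exact_mod_cast hxpos i)]; exact_mod_cast hxle i
  have hus : ∀ i, (s : ℚ) / x i ≤ s := fun i =>
    div_le_self (by linarith) (by exact_mod_cast hxpos i)
  by_contra! hc
  have hcl0 : ∀ r m, 0 ≤ clGK N s ε r m := by
    rintro (i | b) m <;> simp only [clGK] <;> split_ifs <;> positivity
  have hterm : ∀ r, σ r * clGK N s ε r (ν r + 1) < 1 := fun r =>
    (single_le_sum (f := fun r => σ r * clGK N s ε r (ν r + 1))
      (fun j _ => mul_nonneg (hσ0 j) (hcl0 _ _)) (mem_univ r)).trans_lt hc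
  have hsmall : ∀ b, 4 * (s : ℚ) ^ 2 * σ (Sum.inr b) < 1 := fun b => by
    have h := hterm (Sum.inr b)
    simp only [clGK, Nat.succ_ne_zero, if_false] at h
    have h4 : 4 * (s : ℚ) ^ 2 ≤ (s : ℚ) ^ 4 := by
      nlinarith [mul_nonneg (sq_nonneg (s : ℚ)) (by nlinarith : (0 : ℚ) ≤ (s : ℚ) ^ 2 - 4)]
    nlinarith [hσ0 (Sum.inr b)]
  have hbad : ∀ i, ν (Sum.inl i) ≠ 2 → σ (Sum.inl i) * s < 1 := fun i hi => by
    have h := hterm (Sum.inl i)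
    simpa [clGK, hi] using h
  -- some resource with two followers is played by the leader
  have hgood : ∃ i, ν (Sum.inl i) = 2 ∧ 0 < σ (Sum.inl i) := by
    by_contra! hno2
    refine absurd hc (not_lt.2 ?_)
    rw [← hσ.2]
    refine sum_le_sum fun r _ => ?_
    rcases r with i | b
    · by_cases hi : ν (Sum.inl i) = 2
      · have : σ (Sum.inl i) = 0 := le_antisymm (hno2 i hi) (hσ0 _)
        simp [this]
      · have : clGK N s ε (Sum.inl i) (ν (Sum.inl i) + 1) = s := by simp [clGK, hi]
        rw [this]; nlinarith [hσ0 (Sum.inl i)]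
    · have : clGK N s ε (Sum.inr b) (ν (Sum.inr b) + 1) = (s : ℚ) ^ 4 := by simp [clGK]
      rw [this]
      have : (1 : ℚ) ≤ (s : ℚ) ^ 4 := one_le_pow₀ (by linarith)
      nlinarith [hσ0 (Sum.inr b)]
  obtain ⟨g, hg2, hgpos⟩ := hgood
  have hbelow : ∀ m, expCost (cfGK N K s x (Sum.inr false)) (σ (Sum.inr false)) m
      ≤ 3 * (s : ℚ) ^ 2 := fun m =>
    expCost_le (hσ0 _) (hσ1 _) (cfGK_inr_false_le (by omega) _) (cfGK_inr_false_le (by omega) _)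
  have ht2 : ν (Sum.inr true) ≤ 1 := by
    by_contra! h
    have h1 := hne (Sum.inr true) (Sum.inr false) (by simp) (by omega)
    rw [expCost_inr_true_of_two_le _ h] at h1
    nlinarith [hbelow (ν (Sum.inr false) + 1)]
  have hr4 : ∀ i, ν (Sum.inl i) ≤ 4 := fun i => by
    by_contra! h
    have h1 := hne (Sum.inl i) (Sum.inr false) (by simp) (by omega)
    rw [expCost_inl_of_five_le _ _ h] at h1
    nlinarith [hbelow (ν (Sum.inr false) + 1)]
  have htot : ∑ i, ν (Sum.inl i) + (ν (Sum.inr true) + ν (Sum.inr false)) = 4 * N + 2 := by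
    have h := hν
    rw [IsConfig, Fintype.sum_sum_type, Fintype.sum_bool] at h
    exact h
  have hr4sum : ∑ i, ν (Sum.inl i) ≤ 4 * N := by
    calc ∑ i, ν (Sum.inl i) ≤ ∑ _i : Fin N, 4 := sum_le_sum fun i _ => hr4 i
      _ = 4 * N := by simp [mul_comm]
  have ht1pos : 0 < ν (Sum.inr false) := by omega
  have hdev := hne (Sum.inr false) (Sum.inl g) (by simp) ht1pos
  rw [hg2, expCost_inl_three] at hdev
  have hthree : (s : ℚ) / x g * (1 + σ (Sum.inl g) * (2 * s - (s : ℚ) / x g))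
      ≤ (s : ℚ) * (s + 1) := by
    have h1 := hu1 g
    have h2 := hus g
    generalize (s : ℚ) / x g = u at h1 h2 ⊢
    have h3 : σ (Sum.inl g) * (2 * s - u) ≤ 1 * (2 * s - u) :=
      mul_le_mul_of_nonneg_right (hσ1 _) (by linarith)
    have h4 : u * (1 + σ (Sum.inl g) * (2 * s - u)) ≤ u * (1 + 1 * (2 * s - u)) :=
      mul_le_mul_of_nonneg_left (by linarith) (by linarith)
    nlinarith
  have ht1lower : 4 * N - 2 * K + 1 ≤ ν (Sum.inr false) := by
    by_contra! h
    rcases (Nat.lt_succ_iff.1 h).lt_or_eq with h1 | h1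
    · rw [expCost_inr_false_of_lt _ ht1pos h1] at hdev
      nlinarith
    · rw [expCost_inr_false_of_eq _ ht1pos h1] at hdev
      nlinarith [hsmall false, mul_nonneg (hσ0 (Sum.inr false)) (by linarith : (0 : ℚ) ≤ s)]
  have ht1 : ν (Sum.inr false) = 4 * N - 2 * K + 1 := by
    by_contra h
    have h1 := hne (Sum.inl g) (Sum.inr false) (by simp) (by omega)
    rw [hg2, expCost_inl_two, expCost_inr_false_of_add_three_le _ (by omega)] at h1
    nlinarith [hu1 g]
  have ht2' : ν (Sum.inr true) = 1 := by
    by_contra h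
    have h0 : ν (Sum.inr true) = 0 := by omega
    have h1 := hne (Sum.inr false) (Sum.inr true) (by simp) ht1pos
    rw [ht1, h0, zero_add, expCost_inr_false_add_one, expCost_inr_true_one] at h1
    nlinarith [hsmall false, hsmall true, hσ0 (Sum.inr false), hσ0 (Sum.inr true)]
  have hsumK : ∑ i, ν (Sum.inl i) = 2 * K := by omega
  have hp : σ (Sum.inr false) = 0 ∧ σ (Sum.inr true) = 0 := by
    have h1 := hne (Sum.inr true) (Sum.inr false) (by simp) (by omega)
    rw [ht1, ht2', expCost_inr_true_one, expCost_inr_false_add_two] at h1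
    have h2 := hσ0 (Sum.inr false)
    have h3 := hσ0 (Sum.inr true)
    constructor <;> nlinarith [mul_nonneg h3 (by nlinarith : (0 : ℚ) ≤ 4 * (s : ℚ) ^ 2 - 2)]
  have hto : ∀ i, 0 < ν (Sum.inl i) →
      expCost (cfGK N K s x (Sum.inl i)) (σ (Sum.inl i)) (ν (Sum.inl i)) ≤ 1 := fun i hi => by
    have h1 := hne (Sum.inl i) (Sum.inr false) (by simp) hi
    rwa [ht1, expCost_inr_false_add_two, hp.1, sub_zero] at h1
  have hfrom : ∀ i, 2 * (s : ℚ) ≤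
      expCost (cfGK N K s x (Sum.inl i)) (σ (Sum.inl i)) (ν (Sum.inl i) + 1) := fun i => by
    have h1 := hne (Sum.inr false) (Sum.inl i) (by simp) ht1pos
    rwa [ht1, expCost_inr_false_add_one, hp.1, zero_add, sub_zero, one_mul] at h1
  have hvals : ∀ i, (ν (Sum.inl i) = 0 ∧ σ (Sum.inl i) = 0) ∨
      (ν (Sum.inl i) = 2 ∧ σ (Sum.inl i) * s = x i) ∨
      (ν (Sum.inl i) = 3 ∧ σ (Sum.inl i) = 0 ∧ x i = s) := fun i =>
    followers_cases hs (hxpos i) (hxle i) (hσ0 _) (hσ1 _) (hr4 i) (hbad i) (hto i) (hfrom i)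
  set G : Finset (Fin N) := univ.filter fun i => ν (Sum.inl i) = 2 with hG
  set T : Finset (Fin N) := univ.filter fun i => ν (Sum.inl i) = 3 with hT
  have hσG : ∑ i ∈ G, x i = s := by
    have h1 := hσ.2
    rw [Fintype.sum_sum_type, Fintype.sum_bool, hp.1, hp.2, add_zero, add_zero] at h1
    have h2 : ∑ i ∈ G, (x i : ℚ) = ∑ i, σ (Sum.inl i) * s := by
      rw [hG, sum_filter]
      refine sum_congr rfl fun i _ => ?_
      rcases hvals i with ⟨h, h'⟩ | ⟨h, h'⟩ | ⟨h, h', -⟩ <;> simp [h, h']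
    rw [← sum_mul, h1, one_mul] at h2
    exact_mod_cast h2
  have hcount : 2 * G.card + 3 * T.card = 2 * K := by
    rw [← hsumK, hG, hT, card_filter, card_filter, mul_sum, mul_sum, ← sum_add_distrib]
    refine sum_congr rfl fun i _ => ?_
    rcases hvals i with ⟨h, -⟩ | ⟨h, -⟩ | ⟨h, -⟩ <;> simp [h]
  have hTsum : ∑ i ∈ T, x i = T.card * s := by
    rw [← smul_eq_mul, ← sum_const]
    refine sum_congr rfl fun i hi => ?_
    have h3 : ν (Sum.inl i) = 3 := (mem_filter.1 hi).2
    rcases hvals i with ⟨h, -⟩ | ⟨h, -⟩ | ⟨-, -, h⟩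
    · omega
    · omega
    · exact h
  have hdisj : Disjoint G T := disjoint_filter.2 fun i _ h => by omega
  have hunion : ∑ i ∈ G, x i + ∑ i ∈ T, x i ≤ 2 * s := by
    rw [← sum_union hdisj, ← hsum]
    exact sum_le_sum_of_subset (subset_univ _)
  have hTcard : T.card ≤ 1 := by
    rw [hσG, hTsum] at hunion
    by_contra! h
    nlinarith
  exact hno ⟨G, by omega, hσG⟩
end

section
/- Let x_1, …, x_N be positive integers with N even, Σ_i x_i even, s := (Σ_i x_i)/2, s ≥ 2, x_i < s for all i, and w_i := x_i/s; fix a rational ε with 0 < ε < 1. In the game Γ_ε(S) (an SSSCG defined in the context), there exists a leader strategy σ_ℓ such that every configuration ν ∈ E^{σ_ℓ} yields leader's expected cost c_ℓ^{(σ_ℓ,ν)} = ε if and only if there exists a set I ⊆ {1, …, N} with Σ_{i∈I} x_i = s. -/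
open Finset

/-! The game `Γ_ε(S)`. Resources are `some i` (the resource `r_i` associated with the
integer `x_i`, `i < N`) and `none` (the resource `r_t`). There are `3N` followers. Below,
`w_i = x_i / s`, so that `1/(w_i − 1/s⁴) = s⁴/(x_i·s³ − 1)` and
`1/(1 − w_i − 1/s⁴) = s⁴/(s⁴ − x_i·s³ − 1)`. -/

/-- The followers' cost functions of `Γ_ε(S)`. -/
def cfGP (N s : ℕ) (x : Fin N → ℕ) : Option (Fin N) → ℕ → ℚ := fun r m =>
  match r with
  | some i =>
      if m = 0 then 0
      else if m = 1 then 0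
      else if m = 2 then (s : ℚ) ^ 4 / ((x i : ℚ) * (s : ℚ) ^ 3 - 1)
      else if m = 3 then (s : ℚ) ^ 4 / ((s : ℚ) ^ 4 - (x i : ℚ) * (s : ℚ) ^ 3 - 1)
      else if m = 4 then 0
      else (s : ℚ)
  | none => if m = 0 then 0 else 1

/-- The leader's cost functions of `Γ_ε(S)`. -/
def clGP (N s : ℕ) (ε : ℚ) : Option (Fin N) → ℕ → ℚ := fun r m =>
  match r with
  | some _ => if m = 0 then 0 else if m = 2 ∨ m = 4 then (s : ℚ) ^ 4 else ε
  | none => if m = 0 then 0 else (s : ℚ) ^ 4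

/-- A mixture of costs that are all at least `a` equals `a` iff every cost in its support does. -/
theorem sum_mul_eq_iff_of_le {R : Type} [Fintype R] {σ c : R → ℚ} {a : ℚ}
    (hσ : IsStrategy σ) (hc : ∀ r, a ≤ c r) :
    ∑ r, σ r * c r = a ↔ ∀ r, σ r ≠ 0 → c r = a := by
  have h : ∑ r, σ r * c r = a ↔ ∑ r, σ r * (c r - a) = 0 := by
    simp only [mul_sub, Finset.sum_sub_distrib, ← Finset.sum_mul, hσ.2, one_mul, sub_eq_zero]
  rw [h, Finset.sum_eq_zero_iff_of_nonneg fun r _ => mul_nonneg (hσ.1 r) (sub_nonneg.2 (hc r))]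
  simp [sub_eq_zero, or_iff_not_imp_left]

theorem IsStrategy.le_one {R : Type} [Fintype R] {σ : R → ℚ} (hσ : IsStrategy σ) (r : R) :
    σ r ≤ 1 :=
  hσ.2 ▸ Finset.single_le_sum (fun i _ => hσ.1 i) (Finset.mem_univ r)

theorem le_clGP {N s : ℕ} (hs : 2 ≤ s) {ε : ℚ} (hε1 : ε < 1) (r : Option (Fin N)) (m : ℕ) :
    ε ≤ clGP N s ε r (m + 1) := by
  have h : ε ≤ (s : ℚ) ^ 4 := hε1.le.trans (one_le_pow₀ (by exact_mod_cast (by omega : 1 ≤ s)))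
  cases r with
  | none => simpa [clGP] using h
  | some i =>
    simp only [clGP, Nat.succ_ne_zero, if_false]
    split_ifs
    · exact h
    · exact le_rfl

/-- The leader pays `ε` iff she never selects `r_t` and no `r_i` in her support is used by exactly
one or three followers. -/
theorem leaderCost_clGP_eq_iff {N s : ℕ} (hs : 2 ≤ s) {ε : ℚ} (hε1 : ε < 1)
    {σ : Option (Fin N) → ℚ} (hσ : IsStrategy σ) (ν : Option (Fin N) → ℕ) :
    leaderCost (clGP N s ε) σ ν = ε ↔
      σ none = 0 ∧ ∀ i, σ (some i) ≠ 0 → ν (some i) ≠ 1 ∧ ν (some i) ≠ 3 := by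
  have h : (s : ℚ) ^ 4 ≠ ε :=
    (hε1.trans_le (one_le_pow₀ (by exact_mod_cast (by omega : 1 ≤ s)))).ne'
  rw [leaderCost, sum_mul_eq_iff_of_le hσ fun r => le_clGP hs hε1 r (ν r), Option.forall]
  refine and_congr ?_ (forall_congr' fun i => imp_congr_right fun _ => ?_)
  · simp [clGP, h]
  · by_cases h' : ν (some i) = 1 ∨ ν (some i) = 3 <;> simp [clGP, h, h'] <;> tauto

section FollowerCosts

variable {N s : ℕ} {x : Fin N → ℕ} {i : Fin N}

theorem mul_pow_sub_one_pos (hs : 2 ≤ s) (hx : 0 < x i) : 0 < (x i : ℚ) * (s : ℚ) ^ 3 - 1 := by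
  have h1 : (1 : ℚ) ≤ x i := by exact_mod_cast hx
  have h2 : (1 : ℚ) < (s : ℚ) ^ 3 := one_lt_pow₀ (by exact_mod_cast hs) (by norm_num)
  nlinarith

theorem pow_sub_mul_pow_sub_one_pos (hs : 2 ≤ s) (hx : x i < s) :
    0 < (s : ℚ) ^ 4 - (x i : ℚ) * (s : ℚ) ^ 3 - 1 := by
  have h1 : (x i : ℚ) + 1 ≤ s := by exact_mod_cast hx
  have h2 : (1 : ℚ) < (s : ℚ) ^ 3 := one_lt_pow₀ (by exact_mod_cast hs) (by norm_num)
  nlinarith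

theorem expCost_cfGP_none (p : ℚ) {m : ℕ} (hm : 0 < m) : expCost (cfGP N s x none) p m = 1 := by
  simp [expCost, cfGP, hm.ne']

theorem expCost_cfGP_some_one_le_iff (hs : 2 ≤ s) (hx : 0 < x i) (p : ℚ) :
    expCost (cfGP N s x (some i)) p 1 ≤ 1 ↔ p * (s : ℚ) ^ 4 ≤ (x i : ℚ) * (s : ℚ) ^ 3 - 1 := by
  simp only [expCost, cfGP]
  norm_num
  rw [← mul_div_assoc, div_le_one (mul_pow_sub_one_pos hs hx)]

theorem expCost_cfGP_some_three_le_iff (hs : 2 ≤ s) (hx : x i < s) (p : ℚ) :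
    expCost (cfGP N s x (some i)) p 3 ≤ 1 ↔ (x i : ℚ) * (s : ℚ) ^ 3 + 1 ≤ p * (s : ℚ) ^ 4 := by
  simp only [expCost, cfGP]
  norm_num
  rw [← mul_div_assoc, div_le_one (pow_sub_mul_pow_sub_one_pos hs hx)]
  constructor <;> intro h <;> linarith

theorem one_le_expCost_cfGP_some_two (hs : 2 ≤ s) (hx0 : 0 < x i) (hxs : x i < s) {p : ℚ}
    (hp0 : 0 ≤ p) (hp1 : p ≤ 1) : 1 ≤ expCost (cfGP N s x (some i)) p 2 := by
  have hA := mul_pow_sub_one_pos hs hx0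
  have hB := pow_sub_mul_pow_sub_one_pos hs hxs
  have h1 := (one_le_div hA).2
    (by linarith : (x i : ℚ) * (s : ℚ) ^ 3 - 1 ≤ (s : ℚ) ^ 4)
  have h2 := (one_le_div hB).2
    (by linarith : (s : ℚ) ^ 4 - (x i : ℚ) * (s : ℚ) ^ 3 - 1 ≤ (s : ℚ) ^ 4)
  simp only [expCost, cfGP]
  norm_num
  nlinarith

theorem one_le_expCost_cfGP_some_four (hs : 2 ≤ s) (hx : 0 < x i) {p : ℚ}
    (hp : (x i : ℚ) * (s : ℚ) ^ 3 + 1 ≤ p * (s : ℚ) ^ 4) :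
    1 ≤ expCost (cfGP N s x (some i)) p 4 := by
  have h1 : (1 : ℚ) ≤ x i := by exact_mod_cast hx
  have h2 : (0 : ℚ) < (s : ℚ) ^ 3 := pow_pos (by exact_mod_cast (by omega : 0 < s)) 3
  simp only [expCost, cfGP]
  norm_num
  by_contra! h
  nlinarith

end FollowerCosts

/-- The load of `r_i`, selected by the leader with probability `p`, at which each follower on it
pays at most `1` and a further one would pay at least `1`; here `y = x_i`. -/
def equilibriumLoad (s y : ℕ) (p : ℚ) : ℕ :=
  if p * (s : ℚ) ^ 4 ≤ (y : ℚ) * (s : ℚ) ^ 3 - 1 then 1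
  else if (y : ℚ) * (s : ℚ) ^ 3 + 1 ≤ p * (s : ℚ) ^ 4 then 3
  else 0

theorem equilibriumLoad_le (s y : ℕ) (p : ℚ) : equilibriumLoad s y p ≤ 3 := by
  unfold equilibriumLoad
  split_ifs <;> omega

/-- Each `r_i` carries its equilibrium load and the remaining followers select `r_t`. -/
def equilibriumConfig (N s : ℕ) (x : Fin N → ℕ) (σ : Option (Fin N) → ℚ) :
    Option (Fin N) → ℕ
  | none => 3 * N - ∑ i, equilibriumLoad s (x i) (σ (some i))
  | some i => equilibriumLoad s (x i) (σ (some i))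

theorem isConfig_equilibriumConfig (N s : ℕ) (x : Fin N → ℕ) (σ : Option (Fin N) → ℚ) :
    IsConfig (3 * N) (equilibriumConfig N s x σ) := by
  have h : ∑ i, equilibriumLoad s (x i) (σ (some i)) ≤ 3 * N :=
    (Finset.sum_le_sum fun i _ => equilibriumLoad_le s (x i) (σ (some i))).trans
      (by simp [mul_comm])
  rw [IsConfig, Fintype.sum_option]
  exact Nat.sub_add_cancel h

theorem isNE_equilibriumConfig {N s : ℕ} {x : Fin N → ℕ} (hs : 2 ≤ s) (hx0 : ∀ i, 0 < x i)
    (hxs : ∀ i, x i < s) {σ : Option (Fin N) → ℚ} (hσ : IsStrategy σ) :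
    IsNE (cfGP N s x) σ (equilibriumConfig N s x σ) := by
  have hle : ∀ r, 0 < equilibriumConfig N s x σ r →
      expCost (cfGP N s x r) (σ r) (equilibriumConfig N s x σ r) ≤ 1 := by
    intro r hr
    cases r with
    | none => exact (expCost_cfGP_none _ hr).le
    | some i =>
      simp only [equilibriumConfig, equilibriumLoad] at hr ⊢
      split_ifs at hr ⊢ with h1 h3
      · exact (expCost_cfGP_some_one_le_iff hs (hx0 i) _).2 h1
      · exact (expCost_cfGP_some_three_le_iff hs (hxs i) _).2 h3
      · omega
  have hge : ∀ r, 1 ≤ expCost (cfGP N s x r) (σ r) (equilibriumConfig N s x σ r + 1) := by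
    intro r
    cases r with
    | none => exact (expCost_cfGP_none _ (Nat.succ_pos _)).ge
    | some i =>
      simp only [equilibriumConfig, equilibriumLoad]
      split_ifs with h1 h3
      · exact one_le_expCost_cfGP_some_two hs (hx0 i) (hxs i) (hσ.1 _) (hσ.le_one _)
      · exact one_le_expCost_cfGP_some_four hs (hx0 i) h3
      · exact (not_le.1 (mt (expCost_cfGP_some_one_le_iff hs (hx0 i) _).1 h1)).le
  exact fun r r' _ hr => (hle r hr).trans (hge r')

/-- A strategy supported on the `r_i` with probabilities within `1/s⁴` of the `w_i` has a support
that solves the partition instance. -/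
theorem sum_support_eq_of_abs_sub_lt {N s : ℕ} {x : Fin N → ℕ} (hs : 2 ≤ s)
    (hx0 : ∀ i, 0 < x i) (hsum : ∑ i, x i = 2 * s) {p : Fin N → ℚ} (hp : ∑ i, p i = 1)
    (h : ∀ i, p i ≠ 0 → |p i * (s : ℚ) ^ 4 - x i * (s : ℚ) ^ 3| < 1) :
    ∑ i with p i ≠ 0, x i = s := by
  have hN : N ≤ 2 * s := by
    calc N = ∑ _i : Fin N, 1 := by simp
      _ ≤ ∑ i, x i := Finset.sum_le_sum fun i _ => hx0 i
      _ = 2 * s := hsum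
  have hp' : ∑ i with p i ≠ 0, p i = 1 := by rw [Finset.sum_filter_ne_zero, hp]
  have hs' : (2 : ℚ) ≤ s := by exact_mod_cast hs
  set y := ∑ i with p i ≠ 0, x i with hy
  have hbound : |(s : ℚ) ^ 4 - y * (s : ℚ) ^ 3| ≤ 2 * s := by
    calc |(s : ℚ) ^ 4 - y * (s : ℚ) ^ 3|
        = |∑ i with p i ≠ 0, (p i * (s : ℚ) ^ 4 - x i * (s : ℚ) ^ 3)| := by
          rw [Finset.sum_sub_distrib, ← Finset.sum_mul, ← Finset.sum_mul, hp', hy]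
          push_cast
          rw [one_mul]
      _ ≤ ∑ i with p i ≠ 0, |p i * (s : ℚ) ^ 4 - x i * (s : ℚ) ^ 3| :=
          Finset.abs_sum_le_sum_abs _ _
      _ ≤ ∑ i with p i ≠ 0, (1 : ℚ) :=
          Finset.sum_le_sum fun i hi => (h i (Finset.mem_filter.1 hi).2).le
      _ ≤ N := by
          rw [Finset.sum_const, nsmul_one]
          exact_mod_cast (Finset.card_le_univ _).trans (Fintype.card_fin N).le
      _ ≤ 2 * s := by exact_mod_cast hN
  have hfac : (s : ℚ) ^ 4 - y * (s : ℚ) ^ 3 = (s - y) * (s : ℚ) ^ 3 := by ring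
  have hcube : 2 * (s : ℚ) < (s : ℚ) ^ 3 := by nlinarith [mul_self_nonneg ((s : ℚ) - 2)]
  have hlt : |(s : ℚ) - y| < 1 := by
    rw [hfac, abs_mul, abs_of_pos (by positivity : (0 : ℚ) < (s : ℚ) ^ 3)] at hbound
    by_contra! h1
    nlinarith
  have hlt' : |(s : ℤ) - y| < 1 := by exact_mod_cast hlt
  rw [Int.abs_lt_one_iff] at hlt'
  omega

/-- The leader strategy that selects `r_i` with probability `w_i` for `i ∈ I`. -/
def partitionStrategy {N : ℕ} (s : ℕ) (x : Fin N → ℕ) (I : Finset (Fin N)) :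
    Option (Fin N) → ℚ
  | none => 0
  | some i => if i ∈ I then (x i : ℚ) / s else 0

theorem isStrategy_partitionStrategy {N s : ℕ} {x : Fin N → ℕ} {I : Finset (Fin N)}
    (hs : s ≠ 0) (hI : ∑ i ∈ I, x i = s) : IsStrategy (partitionStrategy s x I) := by
  constructor
  · rintro (_ | i)
    · exact le_rfl
    · simp only [partitionStrategy]
      split_ifs <;> positivity
  · rw [Fintype.sum_option]
    simp only [partitionStrategy, zero_add, Finset.sum_ite_mem, Finset.univ_inter]
    rw [← Finset.sum_div, ← Nat.cast_sum, hI, div_self (by exact_mod_cast hs)]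

theorem IsNE.expCost_cfGP_le_one {N s : ℕ} {x : Fin N → ℕ} {σ : Option (Fin N) → ℚ}
    {ν : Option (Fin N) → ℕ} (hν : IsNE (cfGP N s x) σ ν) {i : Fin N} (hi : 0 < ν (some i)) :
    expCost (cfGP N s x (some i)) (σ (some i)) (ν (some i)) ≤ 1 :=
  (hν (some i) none (Option.some_ne_none i) hi).trans_eq (expCost_cfGP_none _ (Nat.succ_pos _))

/-- In `Γ_ε(S)` there is a leader's strategy for which every induced NE gives the leader an
expected cost of exactly `ε` if and only if the PARTITION instance has answer yes. -/
theorem stmt13 (N s : ℕ) (x : Fin N → ℕ)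
    (hNeven : Even N) (hs2 : 2 ≤ s) (hxpos : ∀ i, 0 < x i) (hxlt : ∀ i, x i < s)
    (hsum : ∑ i, x i = 2 * s)
    (ε : ℚ) (hε0 : 0 < ε) (hε1 : ε < 1) :
    (∃ σ : Option (Fin N) → ℚ, IsStrategy σ ∧
        ∀ ν : Option (Fin N) → ℕ, IsConfig (3 * N) ν → IsNE (cfGP N s x) σ ν →
          leaderCost (clGP N s ε) σ ν = ε) ↔
    (∃ I : Finset (Fin N), ∑ i ∈ I, x i = s) := by
  constructor
  · rintro ⟨σ, hσ, h⟩
    obtain ⟨h0, hsupp⟩ := (leaderCost_clGP_eq_iff hs2 hε1 hσ _).1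
      (h _ (isConfig_equilibriumConfig N s x σ) (isNE_equilibriumConfig hs2 hxpos hxlt hσ))
    refine ⟨_, sum_support_eq_of_abs_sub_lt hs2 hxpos hsum (p := fun i => σ (some i)) ?_ ?_⟩
    · simpa [Fintype.sum_option, h0] using hσ.2
    · intro i hi
      have hload := hsupp i hi
      simp only [equilibriumConfig, equilibriumLoad] at hload
      split_ifs at hload with h1 h3
      · simp at hload
      · simp at hload
      · rw [abs_lt]
        constructor <;> linarith
  · rintro ⟨I, hI⟩
    have hσ := isStrategy_partitionStrategy (by omega) hI
    refine ⟨_, hσ, fun ν _ hν => (leaderCost_clGP_eq_iff hs2 hε1 hσ ν).2 ⟨rfl, fun i hi => ?_⟩⟩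
    have hp : partitionStrategy s x I (some i) * (s : ℚ) ^ 4 = x i * (s : ℚ) ^ 3 := by
      have hs0 : (s : ℚ) ≠ 0 := by exact_mod_cast (by omega : s ≠ 0)
      by_cases hiI : i ∈ I
      · simp only [partitionStrategy, hiI, if_true]
        field_simp
      · simp [partitionStrategy, hiI] at hi
    constructor <;> intro hνi
    · have hle := hν.expCost_cfGP_le_one (i := i) (by omega)
      rw [hνi, expCost_cfGP_some_one_le_iff hs2 (hxpos i), hp] at hle
      linarith
    · have hle := hν.expCost_cfGP_le_one (i := i) (by omega)
      rw [hνi, expCost_cfGP_some_three_le_iff hs2 (hxlt i), hp] at hle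
      linarith
end
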